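/- arXiv:math/0403049 — 2 statements merged into one kernel-verified Lean document; each statement's English description precedes it below -/
import Mathlib

section
/- For every κ > 0, every f ∈ L¹(μ_κ) and every s ∈ ℝ, the generalized translation satisfies the mass-conservation identity ∫_ℝ τ_s f(t) dμ_κ(t) = ∫_ℝ f(t) dμ_κ(t). -/
open MeasureTheory Real Filter Topology

/-- The weighted measure `dμ_κ(t) = |t|^{2κ} dt` on `ℝ`. -/
noncomputable def mu (κ : ℝ) : Measure ℝ :=
  MeasureTheory.volume.withDensity (fun t => ENNReal.ofReal (|t| ^ (2 * κ)))

/-- The normalizing constant `b_κ = Γ(κ+1/2)/(√π Γ(κ))`. -/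
noncomputable def bk (κ : ℝ) : ℝ := Real.Gamma (κ + 1 / 2) / (Real.sqrt π * Real.Gamma κ)

/-- The density `Φ_κ(u) = b_κ (1+u)(1-u²)^{κ-1}`. -/
noncomputable def Phi (κ u : ℝ) : ℝ := bk κ * (1 + u) * (1 - u ^ 2) ^ (κ - 1)

/-- The generalized (Dunkl) translation operator `τ_s` for the group `ℤ₂` on `ℝ`. -/
noncomputable def tau (κ s : ℝ) (f : ℝ → ℂ) (t : ℝ) : ℂ :=
  (1 / 2 : ℂ) * ∫ u in Set.Ioo (-1 : ℝ) 1,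
    (f (Real.sqrt (t ^ 2 + s ^ 2 - 2 * s * t * u)) *
        ((1 + (t - s) / Real.sqrt (t ^ 2 + s ^ 2 - 2 * s * t * u) : ℝ) : ℂ) +
      f (-Real.sqrt (t ^ 2 + s ^ 2 - 2 * s * t * u)) *
        ((1 - (t - s) / Real.sqrt (t ^ 2 + s ^ 2 - 2 * s * t * u) : ℝ) : ℂ)) *
    ((Phi κ u : ℝ) : ℂ)

/-- The measure with density `t ^ p` on the positive half-line. -/
noncomputable def powMeasure (p : ℝ) : Measure ℝ :=
  (volume.restrict (Set.Ioi 0)).withDensity (fun t => ENNReal.ofReal (t ^ p))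

/-- The measure with density `(1 - u ^ 2) ^ (κ - 1)` on `(-1, 1)`. -/
noncomputable def gegenbauerMeasure (κ : ℝ) : Measure ℝ :=
  (volume.restrict (Set.Ioo (-1) 1)).withDensity
    (fun u => ENNReal.ofReal ((1 - u ^ 2) ^ (κ - 1)))

instance (p : ℝ) : SFinite (powMeasure p) := by unfold powMeasure; infer_instance

instance (κ : ℝ) : SFinite (gegenbauerMeasure κ) := by unfold gegenbauerMeasure; infer_instance

lemma ae_powMeasure_pos (p : ℝ) : ∀ᵐ t ∂powMeasure p, 0 < t :=
  (withDensity_absolutelyContinuous _ _).ae_le (ae_restrict_mem measurableSet_Ioi)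

lemma ae_gegenbauerMeasure_mem (κ : ℝ) :
    ∀ᵐ u ∂gegenbauerMeasure κ, u ∈ Set.Ioo (-1 : ℝ) 1 :=
  (withDensity_absolutelyContinuous _ _).ae_le (ae_restrict_mem measurableSet_Ioo)

lemma ae_prod_gegenbauerMeasure_mem (μ : Measure ℝ) [SFinite μ] (κ : ℝ) :
    ∀ᵐ p ∂μ.prod (gegenbauerMeasure κ), p.2 ∈ Set.Ioo (-1 : ℝ) 1 :=
  Measure.quasiMeasurePreserving_snd.ae (ae_gegenbauerMeasure_mem κ)

lemma lintegral_powMeasure (p : ℝ) {g : ℝ → ENNReal} (hg : Measurable g) :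
    ∫⁻ t, g t ∂powMeasure p = ∫⁻ t in Set.Ioi 0, ENNReal.ofReal (t ^ p) * g t := by
  rw [powMeasure, lintegral_withDensity_eq_lintegral_mul _ (by fun_prop) hg]
  rfl

lemma lintegral_gegenbauerMeasure (κ : ℝ) {g : ℝ → ENNReal} (hg : Measurable g) :
    ∫⁻ u, g u ∂gegenbauerMeasure κ =
      ∫⁻ u in Set.Ioo (-1) 1, ENNReal.ofReal ((1 - u ^ 2) ^ (κ - 1)) * g u := by
  rw [gegenbauerMeasure, lintegral_withDensity_eq_lintegral_mul _ (by fun_prop) hg]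
  rfl

/-- The substitution `u = cos θ`. -/
lemma lintegral_gegenbauerMeasure_eq_cos (κ : ℝ) {g : ℝ → ENNReal} (hg : Measurable g) :
    ∫⁻ u, g u ∂gegenbauerMeasure κ =
      ∫⁻ θ in Set.Ioo 0 π, ENNReal.ofReal (sin θ ^ (2 * κ - 1)) * g (cos θ) := by
  have himg : cos '' Set.Ioo 0 π = Set.Ioo (-1) 1 := by
    ext u
    constructor
    · rintro ⟨θ, hθ, rfl⟩
      have hs : 0 < sin θ := sin_pos_of_mem_Ioo hθ
      constructor <;> nlinarith [sin_sq_add_cos_sq θ]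
    · intro hu
      exact ⟨arccos u, ⟨arccos_pos.2 hu.2, arccos_lt_pi.2 hu.1⟩, cos_arccos hu.1.le hu.2.le⟩
  rw [lintegral_gegenbauerMeasure κ hg, ← himg,
    lintegral_image_eq_lintegral_abs_deriv_mul measurableSet_Ioo
      (fun θ _ => (hasDerivAt_cos θ).hasDerivWithinAt) (injOn_cos.mono Set.Ioo_subset_Icc_self)]
  refine setLIntegral_congr_fun measurableSet_Ioo fun θ hθ => ?_
  have hs : 0 < sin θ := sin_pos_of_mem_Ioo hθ
  have hpow : (1 - cos θ ^ 2) ^ (κ - 1) = sin θ ^ (2 * κ - 2) := by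
    rw [← sin_sq, ← rpow_natCast, ← rpow_mul hs.le]
    congr 1
    push_cast
    ring
  simp only [abs_neg, abs_of_pos hs, hpow, ← mul_assoc]
  rw [← ENNReal.ofReal_mul hs.le]
  congr 2
  rw [mul_comm, ← rpow_add_one hs.ne']
  congr 1
  ring

/-- Polar coordinates in the upper half-plane, with the angle recorded by its cosine. -/
lemma measurePreserving_polar (κ : ℝ) :
    MeasurePreserving (fun p : ℝ × ℝ => (p.1 * p.2, p.1 * √(1 - p.2 ^ 2)))
      ((powMeasure (2 * κ)).prod (gegenbauerMeasure κ))
      (volume.prod (powMeasure (2 * κ - 1))) := by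
  have hm : Measurable (fun p : ℝ × ℝ => (p.1 * p.2, p.1 * √(1 - p.2 ^ 2))) := by fun_prop
  refine ⟨hm, Measure.ext_of_lintegral _ fun F hF => ?_⟩
  have hmeas : Measurable fun z : ℝ × ℝ => ENNReal.ofReal (z.2 ^ (2 * κ - 1)) * F z := by fun_prop
  have hset : MeasurableSet ((Set.univ : Set ℝ) ×ˢ Set.Ioi (0 : ℝ)) :=
    MeasurableSet.univ.prod measurableSet_Ioi
  have hR : ∫⁻ z, F z ∂(volume.prod (powMeasure (2 * κ - 1))) =
      ∫⁻ z, ((Set.univ : Set ℝ) ×ˢ Set.Ioi (0 : ℝ)).indicator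
        (fun z => ENNReal.ofReal (z.2 ^ (2 * κ - 1)) * F z) z := by
    rw [powMeasure, prod_withDensity_right (by fun_prop),
      lintegral_withDensity_eq_lintegral_mul _ (by fun_prop) hF, lintegral_indicator hset,
      Measure.volume_eq_prod, ← Measure.prod_restrict, Measure.restrict_univ]
    rfl
  rw [hR, ← lintegral_comp_polarCoord_symm, lintegral_map hF hm,
    lintegral_prod (fun p : ℝ × ℝ => F (p.1 * p.2, p.1 * √(1 - p.2 ^ 2)))
      (hF.comp hm).aemeasurable,
    lintegral_powMeasure (2 * κ)
      (g := fun t => ∫⁻ u, F (t * u, t * √(1 - u ^ 2)) ∂gegenbauerMeasure κ)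
      (hF.comp hm).lintegral_prod_right', polarCoord_target,
    Measure.volume_eq_prod, ← Measure.prod_restrict, lintegral_prod]
  · refine setLIntegral_congr_fun measurableSet_Ioi fun t ht => ?_
    have ht : 0 < t := ht
    simp only [polarCoord_symm_apply]
    have hsub : Set.Ioo 0 π ⊆ Set.Ioo (-π) π :=
      Set.Ioo_subset_Ioo_left (by linarith [pi_pos])
    rw [lintegral_gegenbauerMeasure_eq_cos κ (g := fun u => F (t * u, t * √(1 - u ^ 2)))
      (by fun_prop), ← lintegral_const_mul _ (by fun_prop), ← Set.inter_eq_left.2 hsub,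
      ← setLIntegral_indicator measurableSet_Ioo]
    refine setLIntegral_congr_fun measurableSet_Ioo fun θ hθ => ?_
    by_cases hθ' : θ ∈ Set.Ioo 0 π
    · have hs : 0 < sin θ := sin_pos_of_mem_Ioo hθ'
      have hmem : (t * cos θ, t * sin θ) ∈ (Set.univ : Set ℝ) ×ˢ Set.Ioi (0 : ℝ) :=
        ⟨trivial, mul_pos ht hs⟩
      simp only [Set.indicator_of_mem hmem, Set.indicator_of_mem hθ', ← sin_sq, sqrt_sq hs.le,
        smul_eq_mul, ← mul_assoc]
      rw [← ENNReal.ofReal_mul (by positivity), ← ENNReal.ofReal_mul ht.le,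
        mul_rpow ht.le hs.le, rpow_sub_one ht.ne']
      congr 2
      field_simp
    · have hs : sin θ ≤ 0 := sin_nonpos_of_nonpos_of_neg_pi_le
        (not_lt.1 fun h => hθ' ⟨h, hθ.2⟩) hθ.1.le
      rw [Set.indicator_of_notMem hθ', Set.indicator_of_notMem, smul_zero]
      rintro ⟨-, h⟩
      exact absurd h (not_lt.2 (mul_nonpos_of_nonneg_of_nonpos ht.le hs))
  · simp only [polarCoord_symm_apply, smul_eq_mul]
    exact (Measurable.mul (by fun_prop)
      ((hmeas.indicator hset).comp (by fun_prop))).aemeasurable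

lemma bk_pos {κ : ℝ} (hκ : 0 < κ) : 0 < bk κ := by
  have := Gamma_pos_of_pos hκ
  have := Gamma_pos_of_pos (by linarith : 0 < κ + 1 / 2)
  unfold bk
  positivity

lemma gegenbauerMeasure_univ {κ : ℝ} (hκ : 0 < κ) :
    gegenbauerMeasure κ Set.univ = ENNReal.ofReal (bk κ)⁻¹ := by
  have hb := ProbabilityTheory.beta_pos hκ hκ
  have himg : (fun x : ℝ => 2 * x - 1) '' Set.Ioo 0 1 = Set.Ioo (-1) 1 := by
    ext u
    constructor
    · rintro ⟨x, hx, rfl⟩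
      exact ⟨by linarith [hx.1], by linarith [hx.2]⟩
    · intro hu
      exact ⟨(u + 1) / 2, ⟨by linarith [hu.1], by linarith [hu.2]⟩, by ring⟩
  have hder (x : ℝ) : HasDerivAt (fun x : ℝ => 2 * x - 1) 2 x := by
    simpa using ((hasDerivAt_id x).const_mul 2).sub_const 1
  have hone := ProbabilityTheory.lintegral_betaPDF_eq_one hκ hκ
  rw [ProbabilityTheory.lintegral_betaPDF] at hone
  rw [← lintegral_one, lintegral_gegenbauerMeasure κ measurable_const, ← himg,
    lintegral_image_eq_lintegral_abs_deriv_mul measurableSet_Ioo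
      (fun x _ => (hder x).hasDerivWithinAt) (fun x _ y _ h => by simpa using h)]
  calc
    _ = ∫⁻ x in Set.Ioo (0 : ℝ) 1,
        ENNReal.ofReal (2 * 4 ^ (κ - 1) * ProbabilityTheory.beta κ κ) *
        ENNReal.ofReal (1 / ProbabilityTheory.beta κ κ * x ^ (κ - 1) * (1 - x) ^ (κ - 1)) := by
      refine setLIntegral_congr_fun measurableSet_Ioo fun x hx => ?_
      have h1 : 0 < 1 - x := by linarith [hx.2]
      have h2 : 1 - (2 * x - 1) ^ 2 = 4 * x * (1 - x) := by ring
      have h3 := hx.1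
      simp only [h2, mul_one]
      rw [← ENNReal.ofReal_mul (by positivity), ← ENNReal.ofReal_mul (by positivity),
        mul_rpow (by positivity) h1.le, mul_rpow (by positivity) h3.le, abs_of_pos two_pos]
      congr 1
      field_simp
    _ = ENNReal.ofReal (2 * 4 ^ (κ - 1) * ProbabilityTheory.beta κ κ) := by
      rw [lintegral_const_mul' _ _ ENNReal.ofReal_ne_top, hone, mul_one]
    _ = _ := by
      congr 1
      have hdup := Gamma_mul_Gamma_add_half κ
      have hG := Gamma_pos_of_pos hκ
      have hG' := Gamma_pos_of_pos (by linarith : 0 < κ + 1 / 2)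
      have hG2 := Gamma_pos_of_pos (by linarith : 0 < 2 * κ)
      have h4 : (2 : ℝ) * 4 ^ (κ - 1) * 2 ^ (1 - 2 * κ) = 1 := by
        rw [show (4 : ℝ) = 2 ^ (2 : ℝ) by norm_num, ← rpow_mul two_pos.le, mul_assoc,
          ← rpow_add two_pos, show 2 * (κ - 1) + (1 - 2 * κ) = -1 by ring]
        norm_num
      rw [ProbabilityTheory.beta, ← two_mul, bk, inv_div, mul_div_assoc', div_eq_div_iff
        hG2.ne' hG'.ne']
      linear_combination (2 * 4 ^ (κ - 1) * Gamma κ) * hdup + Gamma κ * Gamma (2 * κ) * √π * h4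

lemma measurePreserving_neg_gegenbauerMeasure (κ : ℝ) :
    MeasurePreserving (fun u : ℝ => -u) (gegenbauerMeasure κ) (gegenbauerMeasure κ) := by
  refine ⟨measurable_neg, Measure.ext_of_lintegral _ fun F hF => ?_⟩
  rw [lintegral_map hF measurable_neg,
    lintegral_gegenbauerMeasure κ (g := fun u => F (-u)) (by fun_prop),
    lintegral_gegenbauerMeasure κ hF,
    ← (Measure.measurePreserving_neg (volume : Measure ℝ)).setLIntegral_comp_preimage
      measurableSet_Ioo (by fun_prop)]
  simp

lemma mu_eq_add_map_neg (κ : ℝ) :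
    mu κ = powMeasure (2 * κ) + (powMeasure (2 * κ)).map (fun t => -t) := by
  refine Measure.ext_of_lintegral _ fun F hF => ?_
  rw [lintegral_add_measure, lintegral_map hF measurable_neg, lintegral_powMeasure _ hF,
    lintegral_powMeasure _ (g := fun t => F (-t)) (by fun_prop), mu,
    lintegral_withDensity_eq_lintegral_mul _ (by fun_prop) hF,
    ← lintegral_add_compl _ (measurableSet_Ioi (a := (0 : ℝ))), Set.compl_Ioi,
    setLIntegral_congr Iio_ae_eq_Iic.symm]
  congr 1
  · refine setLIntegral_congr_fun measurableSet_Ioi fun t ht => ?_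
    simp [abs_of_pos (show 0 < t from ht)]
  · rw [← (Measure.measurePreserving_neg (volume : Measure ℝ)).setLIntegral_comp_preimage
      measurableSet_Iio (by fun_prop)]
    simp only [Set.neg_preimage, Set.neg_Iio, neg_zero]
    refine setLIntegral_congr_fun measurableSet_Ioi fun t ht => ?_
    simp [abs_of_pos (show 0 < t from ht)]

/-- The distance to the origin carries the half-plane measure to a multiple of the radial one. -/
lemma measurePreserving_radius (κ : ℝ) :
    MeasurePreserving (fun z : ℝ × ℝ => √(z.1 ^ 2 + z.2 ^ 2))
      (volume.prod (powMeasure (2 * κ - 1)))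
      (gegenbauerMeasure κ Set.univ • powMeasure (2 * κ)) := by
  have hm : Measurable (fun z : ℝ × ℝ => √(z.1 ^ 2 + z.2 ^ 2)) := by fun_prop
  refine ⟨hm, ?_⟩
  rw [← (measurePreserving_polar κ).map_eq,
    Measure.map_map hm (measurePreserving_polar κ).measurable, ← Measure.map_fst_prod]
  refine Measure.map_congr ?_
  filter_upwards [ae_prod_gegenbauerMeasure_mem (powMeasure (2 * κ)) κ,
    Measure.quasiMeasurePreserving_fst.ae (ae_powMeasure_pos (2 * κ))] with p hu ht
  have h1 : 0 ≤ 1 - p.2 ^ 2 := by nlinarith [hu.1, hu.2]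
  simp only [Function.comp_apply]
  rw [mul_pow, mul_pow, sq_sqrt h1, ← mul_add, add_sub_cancel, mul_one, sqrt_sq ht.le]

/-- Polar coordinates around the point `(-s, 0)` of the upper half-plane. -/
lemma measurePreserving_polar_sub (κ s : ℝ) :
    MeasurePreserving (fun p : ℝ × ℝ => (p.1 * p.2 - s, p.1 * √(1 - p.2 ^ 2)))
      ((powMeasure (2 * κ)).prod (gegenbauerMeasure κ))
      (volume.prod (powMeasure (2 * κ - 1))) :=
  ((measurePreserving_sub_right volume s).prod (MeasurePreserving.id _)).comp
    (measurePreserving_polar κ)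

/-- The side opposite to the angle of cosine `u` in a triangle with adjacent sides `s`, `t`. -/
noncomputable def chord (s t u : ℝ) : ℝ := √(t ^ 2 + s ^ 2 - 2 * s * t * u)

lemma measurable_chord (s : ℝ) : Measurable fun p : ℝ × ℝ => chord s p.1 p.2 := by
  unfold chord
  fun_prop

lemma chord_neg_neg (s t u : ℝ) : chord s (-t) (-u) = chord s t u := by
  unfold chord
  congr 1
  ring

lemma chord_eq_radius {u : ℝ} (hu : u ∈ Set.Ioo (-1 : ℝ) 1) (s t : ℝ) :
    chord s t u = √((t * u - s) ^ 2 + (t * √(1 - u ^ 2)) ^ 2) := by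
  rw [mul_pow, sq_sqrt (by nlinarith [hu.1, hu.2]), chord]
  congr 1
  ring

lemma abs_mul_div_chord_le {u : ℝ} (hu : u ∈ Set.Ioo (-1 : ℝ) 1) (s t : ℝ) :
    |(t - s) * (1 + u) / chord s t u| ≤ 2 := by
  have hu2 : 0 ≤ 1 - u ^ 2 := by nlinarith [hu.1, hu.2]
  have h1 : |t - s * u| ≤ chord s t u :=
    abs_le_sqrt (by nlinarith [mul_nonneg (sq_nonneg s) hu2])
  have h2 : |t * u - s| ≤ chord s t u :=
    abs_le_sqrt (by nlinarith [mul_nonneg (sq_nonneg t) hu2])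
  have h0 : 0 ≤ chord s t u := sqrt_nonneg _
  rw [abs_div, abs_of_nonneg h0]
  refine div_le_of_le_mul₀ h0 zero_le_two ?_
  calc |(t - s) * (1 + u)| = |(t - s * u) + (t * u - s)| := by congr 1; ring
    _ ≤ |t - s * u| + |t * u - s| := abs_add_le _ _
    _ ≤ 2 * chord s t u := by linarith

lemma abs_sub_div_chord_le {u : ℝ} (hu : u ∈ Set.Ioo (-1 : ℝ) 1) (s t : ℝ) :
    |(t * u - s) / chord s t u| ≤ 1 := by
  have h0 : 0 ≤ chord s t u := sqrt_nonneg _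
  rw [abs_div, abs_of_nonneg h0]
  refine div_le_one_of_le₀ (abs_le_sqrt ?_) h0
  have hu2 : 0 ≤ 1 - u ^ 2 := by nlinarith [hu.1, hu.2]
  nlinarith [mul_nonneg (sq_nonneg t) hu2]

lemma measurePreserving_chord (κ s : ℝ) :
    MeasurePreserving (fun p : ℝ × ℝ => chord s p.1 p.2)
      ((powMeasure (2 * κ)).prod (gegenbauerMeasure κ))
      (gegenbauerMeasure κ Set.univ • powMeasure (2 * κ)) := by
  refine ⟨measurable_chord s, ?_⟩
  rw [← ((measurePreserving_radius κ).comp (measurePreserving_polar_sub κ s)).map_eq]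
  refine Measure.map_congr ?_
  filter_upwards [ae_prod_gegenbauerMeasure_mem (powMeasure (2 * κ)) κ] with p hu
  exact chord_eq_radius hu s p.1

lemma integral_comp_chord {κ : ℝ} (hκ : 0 < κ) (s : ℝ) {g : ℝ → ℂ}
    (hg : Integrable g (powMeasure (2 * κ))) :
    ∫ p, g (chord s p.1 p.2) ∂(powMeasure (2 * κ)).prod (gegenbauerMeasure κ) =
      ((bk κ)⁻¹ : ℝ) * ∫ t, g t ∂powMeasure (2 * κ) := by
  have hmp := measurePreserving_chord κ s
  rw [← integral_map hmp.measurable.aemeasurable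
    (by rw [hmp.map_eq]; exact hg.aestronglyMeasurable.smul_measure _), hmp.map_eq,
    integral_smul_measure, gegenbauerMeasure_univ hκ,
    ENNReal.toReal_ofReal (inv_nonneg.2 (bk_pos hκ).le), Complex.real_smul]

/-- The horizontal component of a radial field has zero mean over the half-plane. -/
lemma integral_comp_chord_mul_eq_zero {κ : ℝ} (s : ℝ) {g : ℝ → ℂ}
    (hg : Integrable g (powMeasure (2 * κ))) :
    ∫ p, g (chord s p.1 p.2) * ((p.1 * p.2 - s) / chord s p.1 p.2 : ℝ)
      ∂(powMeasure (2 * κ)).prod (gegenbauerMeasure κ) = 0 := by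
  let ψ : ℝ × ℝ → ℂ := fun z =>
    g √(z.1 ^ 2 + z.2 ^ 2) * ((z.1 / √(z.1 ^ 2 + z.2 ^ 2) : ℝ) : ℂ)
  have hψ : AEStronglyMeasurable ψ (volume.prod (powMeasure (2 * κ - 1))) :=
    ((hg.aestronglyMeasurable.smul_measure _).comp_measurePreserving
      (measurePreserving_radius κ)).mul
      (Measurable.aestronglyMeasurable (by fun_prop))
  have hmp := measurePreserving_polar_sub κ s
  have hodd : ∫ z, ψ z ∂volume.prod (powMeasure (2 * κ - 1)) =
      -∫ z, ψ z ∂volume.prod (powMeasure (2 * κ - 1)) := by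
    have hneg : MeasurePreserving (Prod.map (fun x : ℝ => -x) id)
        (volume.prod (powMeasure (2 * κ - 1))) (volume.prod (powMeasure (2 * κ - 1))) :=
      (Measure.measurePreserving_neg volume).prod (MeasurePreserving.id _)
    conv_lhs => rw [← hneg.map_eq]
    rw [integral_map hneg.measurable.aemeasurable (by rwa [hneg.map_eq]), ← integral_neg]
    congr 1 with z
    simp [ψ, neg_div]
  calc
    _ = ∫ p : ℝ × ℝ, ψ (p.1 * p.2 - s, p.1 * √(1 - p.2 ^ 2))
        ∂(powMeasure (2 * κ)).prod (gegenbauerMeasure κ) := by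
      refine integral_congr_ae ?_
      filter_upwards [ae_prod_gegenbauerMeasure_mem (powMeasure (2 * κ)) κ] with p hu
      simp only [ψ, chord_eq_radius hu]
    _ = ∫ z, ψ z ∂volume.prod (powMeasure (2 * κ - 1)) := by
      rw [← hmp.map_eq, integral_map hmp.measurable.aemeasurable (by rwa [hmp.map_eq])]
    _ = 0 := self_eq_neg.1 hodd

/-- The density of `tau κ s f t` with respect to `gegenbauerMeasure κ`, split according to the
even and odd parts of `f`. -/
noncomputable def tauIntegrand (κ s : ℝ) (f : ℝ → ℂ) (t u : ℝ) : ℂ :=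
  (bk κ / 2 : ℝ) * ((f (chord s t u) + f (-chord s t u)) * (1 + u : ℝ) +
    (f (chord s t u) - f (-chord s t u)) * ((t - s) * (1 + u) / chord s t u : ℝ))

lemma tau_eq_integral_tauIntegrand (κ s : ℝ) (f : ℝ → ℂ) (t : ℝ) :
    tau κ s f t = ∫ u, tauIntegrand κ s f t u ∂gegenbauerMeasure κ := by
  rw [gegenbauerMeasure, integral_withDensity_eq_integral_toReal_smul (by fun_prop) (by simp),
    tau, ← integral_const_mul]
  refine setIntegral_congr_fun measurableSet_Ioo fun u hu => ?_
  have h : 0 ≤ 1 - u ^ 2 := by nlinarith [hu.1, hu.2]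
  simp only [ENNReal.toReal_ofReal (rpow_nonneg h _), Complex.real_smul, Phi, tauIntegrand, chord]
  push_cast
  ring

lemma tauIntegrand_add_neg_neg (κ s : ℝ) (f : ℝ → ℂ) (t u : ℝ) :
    tauIntegrand κ s f t u + tauIntegrand κ s f (-t) (-u) =
      (bk κ : ℂ) * (f (chord s t u) + f (-chord s t u)) +
      (bk κ : ℂ) * ((f (chord s t u) - f (-chord s t u)) *
        ((t * u - s) / chord s t u : ℝ)) := by
  simp only [tauIntegrand, chord_neg_neg]
  push_cast
  ring

lemma tau_neg_eq_integral_tauIntegrand (κ s : ℝ) (f : ℝ → ℂ) (t : ℝ) :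
    tau κ s f (-t) = ∫ u, tauIntegrand κ s f (-t) (-u) ∂gegenbauerMeasure κ := by
  rw [tau_eq_integral_tauIntegrand]
  exact ((measurePreserving_neg_gegenbauerMeasure κ).integral_comp
    (MeasurableEquiv.neg ℝ).measurableEmbedding _).symm

lemma integrable_comp_chord {κ : ℝ} (hκ : 0 < κ) (s : ℝ) {g : ℝ → ℂ}
    (hg : Integrable g (powMeasure (2 * κ))) :
    Integrable (fun p : ℝ × ℝ => g (chord s p.1 p.2))
      ((powMeasure (2 * κ)).prod (gegenbauerMeasure κ)) :=
  (measurePreserving_chord κ s).integrable_comp_of_integrable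
    (hg.smul_measure (by simp [gegenbauerMeasure_univ hκ]))

/-- Multiplication by a bounded kernel preserves integrability of functions of the chord. -/
lemma integrable_comp_chord_mul {κ : ℝ} (hκ : 0 < κ) (s : ℝ) {g : ℝ → ℂ}
    (hg : Integrable g (powMeasure (2 * κ))) {k : ℝ × ℝ → ℝ} (hk : Measurable k)
    (hk2 : ∀ t, ∀ u ∈ Set.Ioo (-1 : ℝ) 1, |k (t, u)| ≤ 2) :
    Integrable (fun p : ℝ × ℝ => g (chord s p.1 p.2) * (k p : ℂ))
      ((powMeasure (2 * κ)).prod (gegenbauerMeasure κ)) := by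
  refine (integrable_comp_chord hκ s hg).mul_bdd (c := 2)
    (Complex.measurable_ofReal.comp hk).aestronglyMeasurable ?_
  filter_upwards [ae_prod_gegenbauerMeasure_mem (powMeasure (2 * κ)) κ] with p hu
  simpa using hk2 p.1 p.2 hu

lemma integrable_tauIntegrand {κ : ℝ} (hκ : 0 < κ) (s : ℝ) {f : ℝ → ℂ}
    (hf : Integrable f (powMeasure (2 * κ)))
    (hf' : Integrable (fun t => f (-t)) (powMeasure (2 * κ))) :
    Integrable (fun p : ℝ × ℝ => tauIntegrand κ s f p.1 p.2)
      ((powMeasure (2 * κ)).prod (gegenbauerMeasure κ)) := by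
  have hc := measurable_chord s
  refine ((integrable_comp_chord_mul hκ s (hf.add hf') (k := fun p => 1 + p.2) (by fun_prop)
    fun t u hu => ?_).add (integrable_comp_chord_mul hκ s (hf.sub hf')
      (k := fun p => (p.1 - s) * (1 + p.2) / chord s p.1 p.2) (by fun_prop)
    fun t u hu => abs_mul_div_chord_le hu s t)).const_mul _
  exact abs_le.2 ⟨by linarith [hu.1], by linarith [hu.2]⟩

lemma integrable_tauIntegrand_neg_neg {κ : ℝ} (hκ : 0 < κ) (s : ℝ) {f : ℝ → ℂ}
    (hf : Integrable f (powMeasure (2 * κ)))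
    (hf' : Integrable (fun t => f (-t)) (powMeasure (2 * κ))) :
    Integrable (fun p : ℝ × ℝ => tauIntegrand κ s f (-p.1) (-p.2))
      ((powMeasure (2 * κ)).prod (gegenbauerMeasure κ)) := by
  have hc := measurable_chord s
  simp only [tauIntegrand, chord_neg_neg]
  refine ((integrable_comp_chord_mul hκ s (hf.add hf') (k := fun p => 1 + -p.2) (by fun_prop)
    fun t u hu => ?_).add (integrable_comp_chord_mul hκ s (hf.sub hf')
      (k := fun p => (-p.1 - s) * (1 + -p.2) / chord s p.1 p.2) (by fun_prop)
    fun t u hu => ?_)).const_mul _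
  · exact abs_le.2 ⟨by linarith [hu.2], by linarith [hu.1]⟩
  · simpa [chord_neg_neg] using
      abs_mul_div_chord_le (u := -u) ⟨by linarith [hu.2], by linarith [hu.1]⟩ s (-t)

/-- mass conservation `∫ τ_s f dμ_κ = ∫ f dμ_κ` for `f ∈ L¹(μ_κ)`. -/
theorem translation_mass_conservation (κ : ℝ) (hκ : 0 < κ) (s : ℝ)
    (f : ℝ → ℂ) (hf : Integrable f (mu κ)) :
    Integrable (tau κ s f) (mu κ) ∧
      ∫ t, tau κ s f t ∂(mu κ) = ∫ t, f t ∂(mu κ) := by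
  have hneg : MeasurableEmbedding fun t : ℝ => -t := (MeasurableEquiv.neg ℝ).measurableEmbedding
  have hdecomp {g : ℝ → ℂ} : Integrable g (mu κ) ↔ Integrable g (powMeasure (2 * κ)) ∧
      Integrable (fun t => g (-t)) (powMeasure (2 * κ)) := by
    rw [mu_eq_add_map_neg, integrable_add_measure, hneg.integrable_map_iff]
    rfl
  have hsplit {g : ℝ → ℂ} (hg : Integrable g (mu κ)) : ∫ t, g t ∂mu κ =
      ∫ t, g t ∂powMeasure (2 * κ) + ∫ t, g (-t) ∂powMeasure (2 * κ) := by
    have hg' := hg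
    rw [mu_eq_add_map_neg, integrable_add_measure] at hg'
    rw [mu_eq_add_map_neg, integral_add_measure hg'.1 hg'.2, hneg.integral_map]
  obtain ⟨hf1, hf2⟩ := hdecomp.1 hf
  have hG := integrable_tauIntegrand hκ s hf1 hf2
  have hG' := integrable_tauIntegrand_neg_neg hκ s hf1 hf2
  have hτ : Integrable (tau κ s f) (mu κ) := by
    refine hdecomp.2 ⟨?_, ?_⟩
    · simpa only [← tau_eq_integral_tauIntegrand] using hG.integral_prod_left
    · simpa only [← tau_neg_eq_integral_tauIntegrand] using hG'.integral_prod_left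
  refine ⟨hτ, ?_⟩
  have hadd := hf1.add hf2
  have hsub := hf1.sub hf2
  have heven := integral_comp_chord hκ s hadd
  have hodd := integral_comp_chord_mul_eq_zero s hsub
  have hc := measurable_chord s
  have hint := integrable_comp_chord hκ s hadd
  have hint' := integrable_comp_chord_mul hκ s hsub
    (k := fun p => (p.1 * p.2 - s) / chord s p.1 p.2) (by fun_prop)
    fun t u hu => (abs_sub_div_chord_le hu s t).trans one_le_two
  simp only [Pi.add_apply, Pi.sub_apply] at heven hodd hint hint'
  have hb : (bk κ : ℂ) ≠ 0 := by exact_mod_cast (bk_pos hκ).ne'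
  rw [hsplit hτ, hsplit hf, ← integral_add hf1 hf2]
  simp only [tau_neg_eq_integral_tauIntegrand]
  simp only [tau_eq_integral_tauIntegrand]
  rw [← integral_prod _ hG, ← integral_prod _ hG', ← integral_add hG hG']
  simp only [tauIntegrand_add_neg_neg]
  rw [integral_add (hint.const_mul _) (hint'.const_mul _), integral_const_mul,
    integral_const_mul, hodd, heven]
  push_cast
  rw [mul_zero, add_zero, mul_inv_cancel_left₀ hb]
end

section
/- For every κ > 0 and every s ∈ ℝ, if f, g : ℝ → ℂ are bounded measurable functions belonging to L¹(μ_κ), then ∫_ℝ τ_s f(t) · g(t) dμ_κ(t) = ∫_ℝ f(t) · τ_{−s} g(t) dμ_κ(t). -/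
open MeasureTheory Real Filter Topology

/-- The density `(1 - u²)^{κ-1}` is integrable on `(-1, 1)` for `κ > 0`. -/
lemma integrableOn_one_sub_sq_rpow {κ : ℝ} (hκ : 0 < κ) :
    IntegrableOn (fun u : ℝ => (1 - u ^ 2) ^ (κ - 1)) (Set.Ioo (-1) 1) := by
  have h1 : IntegrableOn (fun u : ℝ => (1 + u) ^ (κ - 1)) (Set.Ioo (-1) 1) := by
    have h := (intervalIntegral.intervalIntegrable_rpow' (a := 0) (b := 2)
      (r := κ - 1) (by linarith)).comp_add_left 1
    rw [intervalIntegrable_iff_integrableOn_Ioo_of_le (by norm_num)] at h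
    norm_num at h
    exact h
  have h2 : IntegrableOn (fun u : ℝ => (1 - u) ^ (κ - 1)) (Set.Ioo (-1) 1) := by
    have h := ((intervalIntegral.intervalIntegrable_rpow' (a := 0) (b := 2)
      (r := κ - 1) (by linarith)).comp_sub_left 1).symm
    rw [intervalIntegrable_iff_integrableOn_Ioo_of_le (by norm_num)] at h
    norm_num at h
    exact h
  have h3 : IntegrableOn (fun _ : ℝ => (1 : ℝ)) (Set.Ioo (-1 : ℝ) 1) :=
    integrableOn_const (by simp)
  refine Integrable.mono' ((h1.add h2).add h3)
    (Measurable.aestronglyMeasurable (by fun_prop)) ?_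
  filter_upwards [ae_restrict_mem measurableSet_Ioo] with u hu
  obtain ⟨hu1, hu2⟩ := hu
  have ha : 0 < 1 + u := by linarith
  have hb : 0 < 1 - u := by linarith
  have hpos : 0 < 1 - u ^ 2 := by nlinarith
  rw [Real.norm_of_nonneg (Real.rpow_nonneg hpos.le _)]
  simp only [Pi.add_apply]
  have hA := Real.rpow_nonneg ha.le (κ - 1)
  have hB := Real.rpow_nonneg hb.le (κ - 1)
  rcases le_or_gt 1 κ with hk | hk
  · have := Real.rpow_le_one hpos.le (by nlinarith) (show 0 ≤ κ - 1 by linarith)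
    linarith
  · rcases le_total u 0 with h | h
    · have := Real.rpow_le_rpow_of_nonpos ha (show 1 + u ≤ 1 - u ^ 2 by nlinarith)
        (show κ - 1 ≤ 0 by linarith)
      linarith
    · have := Real.rpow_le_rpow_of_nonpos hb (show 1 - u ≤ 1 - u ^ 2 by nlinarith)
        (show κ - 1 ≤ 0 by linarith)
      linarith

/-- The factor `1 + u` of `Φ_κ` compensates the singularity of `(t - s) / z` at `z = 0`. -/
lemma abs_one_add_div_mul_one_add_le {s t u z : ℝ} (hu : u ∈ Set.Ioo (-1 : ℝ) 1)
    (hz : z ^ 2 = t ^ 2 + s ^ 2 - 2 * s * t * u) :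
    |(1 + (t - s) / z) * (1 + u)| ≤ 4 := by
  obtain ⟨hu1, hu2⟩ := hu
  have key : |(t - s) / z| * (1 + u) ≤ 2 := by
    rcases eq_or_ne z 0 with rfl | hz0
    · simp
    · have hzp : 0 < |z| := abs_pos.2 hz0
      rw [abs_div, div_mul_eq_mul_div, div_le_iff₀ hzp]
      have h1 : (t - s) ^ 2 * (1 + u) ≤ 2 * z ^ 2 := by
        rw [hz]
        nlinarith [mul_nonneg (sub_nonneg.2 hu2.le) (sq_nonneg (t + s))]
      refine abs_le_of_sq_le_sq' ?_ (by positivity) |>.2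
      rw [mul_pow, mul_pow, sq_abs, sq_abs]
      nlinarith [mul_le_mul_of_nonneg_right h1 (show 0 ≤ 1 + u by linarith), sq_nonneg z]
  rw [abs_mul, abs_of_pos (show 0 < 1 + u by linarith)]
  have := abs_add_le 1 ((t - s) / z)
  rw [abs_one] at this
  nlinarith

/-- The set of `z` for which `(t² + s² - z²) / (2st)` lies in `(-1, 1)`. -/
def translationSupport (s t : ℝ) : Set ℝ :=
  {z | (t ^ 2 + s ^ 2 - z ^ 2) ^ 2 < (2 * s * t) ^ 2}

lemma measurableSet_translationSupport (s t : ℝ) : MeasurableSet (translationSupport s t) :=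
  measurableSet_lt (by fun_prop) (by fun_prop)

lemma mem_translationSupport_symm {s t z : ℝ} :
    t ∈ translationSupport (-s) z ↔ z ∈ translationSupport s t := by
  simp only [translationSupport, Set.mem_ofPred_eq]
  constructor <;> intro h <;> nlinarith

/-- The density of the generalized translation in the variable `z`, weighted by `|t|^{2κ}`. -/
noncomputable def translationDensity (κ s t z : ℝ) : ℝ :=
  |-z / (s * t)| * ((1 + (t - s) / z) * Phi κ ((t ^ 2 + s ^ 2 - z ^ 2) / (2 * s * t))) *
    |t| ^ (2 * κ)

open Classical in
/-- The kernel of the generalized translation with respect to Lebesgue measure in `z`,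
weighted by `|t|^{2κ}`, up to the factor `1 / 2`. -/
noncomputable def translationKernel (κ s t z : ℝ) : ℝ :=
  if z ∈ translationSupport s t then translationDensity κ s t z else 0

lemma translationDensity_symm {κ s t z : ℝ} (hs : s ≠ 0) (ht : t ≠ 0) (hz : z ≠ 0)
    (h : z ∈ translationSupport s t) :
    translationDensity κ (-s) z t = translationDensity κ s t z := by
  have hD : 0 < (2 * s * t) ^ 2 - (t ^ 2 + s ^ 2 - z ^ 2) ^ 2 := sub_pos.2 h
  have hsymm : (2 * -s * z) ^ 2 - (z ^ 2 + (-s) ^ 2 - t ^ 2) ^ 2 =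
      (2 * s * t) ^ 2 - (t ^ 2 + s ^ 2 - z ^ 2) ^ 2 := by ring
  have rp : ∀ x : ℝ, x ≠ 0 → ((2 * s * x) ^ 2) ^ (κ - 1) =
      ((2 * s) ^ 2) ^ (κ - 1) * (|x| ^ (2 * κ) / |x| ^ 2) := by
    intro x hx
    rw [mul_pow, Real.mul_rpow (sq_nonneg _) (sq_nonneg _)]
    congr 1
    rw [← sq_abs x, Real.rpow_sub (by positivity), Real.rpow_one, Real.rpow_mul (abs_nonneg x),
      Real.rpow_two]
  have e1 : ∀ a c : ℝ, c ≠ 0 → 1 - (a / c) ^ 2 = (c ^ 2 - a ^ 2) / c ^ 2 := by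
    intro a c hc
    field_simp
  have hs2 : ((2 * s) ^ 2 : ℝ) ^ (κ - 1) ≠ 0 := (Real.rpow_pos_of_pos (by positivity) _).ne'
  have htp : |t| ^ (2 * κ) ≠ 0 := (Real.rpow_pos_of_pos (abs_pos.2 ht) _).ne'
  have hzp : |z| ^ (2 * κ) ≠ 0 := (Real.rpow_pos_of_pos (abs_pos.2 hz) _).ne'
  have hta : |t| ≠ 0 := abs_ne_zero.2 ht
  have hza : |z| ≠ 0 := abs_ne_zero.2 hz
  have hsa : |s| ≠ 0 := abs_ne_zero.2 hs
  unfold translationDensity Phi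
  rw [e1 _ _ (by simp [hs, hz]), e1 _ _ (by simp [hs, ht]), hsymm,
    show (2 * -s * z) ^ 2 = (2 * s * z) ^ 2 by ring, Real.div_rpow hD.le (sq_nonneg _),
    Real.div_rpow hD.le (sq_nonneg _), rp t ht, rp z hz]
  simp only [abs_div, abs_mul, abs_neg]
  generalize ((2 * s * t) ^ 2 - (t ^ 2 + s ^ 2 - z ^ 2) ^ 2) ^ (κ - 1) = X
  generalize |z| ^ (2 * κ) = Z at *
  generalize |t| ^ (2 * κ) = T at *
  generalize ((2 * s) ^ 2) ^ (κ - 1) = Y at *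
  field_simp
  ring

lemma translationKernel_symm {κ s t z : ℝ} (hs : s ≠ 0) (ht : t ≠ 0) (hz : z ≠ 0) :
    translationKernel κ (-s) z t = translationKernel κ s t z := by
  unfold translationKernel
  by_cases h : z ∈ translationSupport s t
  · rw [if_pos h, if_pos (mem_translationSupport_symm.2 h), translationDensity_symm hs ht hz h]
  · rw [if_neg h, if_neg (mt mem_translationSupport_symm.1 h)]

lemma measurable_translationKernel (κ s : ℝ) :
    Measurable (fun p : ℝ × ℝ => translationKernel κ s p.1 p.2) := by
  unfold translationKernel
  refine Measurable.ite ?_ ?_ measurable_const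
  · exact measurableSet_lt (f := fun p : ℝ × ℝ => (p.1 ^ 2 + s ^ 2 - p.2 ^ 2) ^ 2)
      (g := fun p : ℝ × ℝ => (2 * s * p.1) ^ 2) (by fun_prop) (by fun_prop)
  · unfold translationDensity Phi
    fun_prop

/-- The part of the support on which `z` has the sign of `ε`. -/
def signedSupport (s t ε : ℝ) : Set ℝ := translationSupport s t ∩ {z | 0 < ε * z}

lemma measurableSet_signedSupport (s t ε : ℝ) : MeasurableSet (signedSupport s t ε) :=
  (measurableSet_translationSupport s t).inter (measurableSet_lt (by fun_prop) (by fun_prop))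

lemma div_mem_Ioo_iff {s t z : ℝ} (hs : s ≠ 0) (ht : t ≠ 0) :
    (t ^ 2 + s ^ 2 - z ^ 2) / (2 * s * t) ∈ Set.Ioo (-1 : ℝ) 1 ↔
      z ∈ translationSupport s t := by
  have h0 : 0 < (2 * s * t) ^ 2 := by positivity
  rw [Set.mem_Ioo, ← abs_lt, ← sq_lt_one_iff_abs_lt_one, div_pow, div_lt_one h0]
  rfl

lemma image_signedSupport {s t ε : ℝ} (hs : s ≠ 0) (ht : t ≠ 0) (hε : ε ^ 2 = 1) :
    (fun z : ℝ => (t ^ 2 + s ^ 2 - z ^ 2) / (2 * s * t)) '' signedSupport s t ε =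
      Set.Ioo (-1) 1 := by
  ext u
  constructor
  · rintro ⟨z, hz, rfl⟩
    exact (div_mem_Ioo_iff hs ht).2 hz.1
  · intro hu
    have hpos : 0 < t ^ 2 + s ^ 2 - 2 * s * t * u := by
      obtain ⟨h1, h2⟩ := hu
      rcases lt_or_gt_of_ne (mul_ne_zero hs ht) with h | h
      · nlinarith [sq_nonneg (t + s), mul_pos_of_neg_of_neg h (show -(1 + u) < 0 by linarith)]
      · nlinarith [sq_nonneg (t - s), mul_pos h (show 0 < 1 - u by linarith)]
    have he : (t ^ 2 + s ^ 2 - (ε * √(t ^ 2 + s ^ 2 - 2 * s * t * u)) ^ 2) / (2 * s * t) = u := by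
      rw [mul_pow, hε, Real.sq_sqrt hpos.le]
      field_simp
      ring
    refine ⟨ε * √(t ^ 2 + s ^ 2 - 2 * s * t * u), ⟨(div_mem_Ioo_iff hs ht).1 (by rwa [he]), ?_⟩, he⟩
    have := Real.sqrt_pos.2 hpos
    rw [Set.mem_ofPred_eq, ← mul_assoc, ← sq, hε, one_mul]
    exact this

lemma injOn_signedSupport {s t ε : ℝ} (hs : s ≠ 0) (ht : t ≠ 0) :
    Set.InjOn (fun z : ℝ => (t ^ 2 + s ^ 2 - z ^ 2) / (2 * s * t)) (signedSupport s t ε) := by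
  intro x hx y hy h
  have hx2 : 0 < ε * x := hx.2
  have hy2 : 0 < ε * y := hy.2
  have h1 : t ^ 2 + s ^ 2 - x ^ 2 = t ^ 2 + s ^ 2 - y ^ 2 :=
    (div_left_inj' (by simp [hs, ht])).1 h
  rcases sq_eq_sq_iff_eq_or_eq_neg.1 (show x ^ 2 = y ^ 2 by linarith) with h2 | h2
  · exact h2
  · subst h2
    linarith

lemma hasDerivWithinAt_signedSupport (s t : ℝ) (A : Set ℝ) (z : ℝ) :
    HasDerivWithinAt (fun z : ℝ => (t ^ 2 + s ^ 2 - z ^ 2) / (2 * s * t)) (-z / (s * t)) A z := by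
  have h := (((hasDerivAt_pow 2 z).const_sub (t ^ 2 + s ^ 2)).div_const (2 * s * t))
  refine (h.congr_deriv ?_).hasDerivWithinAt
  rw [show 2 * s * t = 2 * (s * t) by ring, show -z / (s * t) = (2 * -z) / (2 * (s * t)) from
    (mul_div_mul_left _ _ two_ne_zero).symm]
  norm_num

lemma signed_sqrt_eq {s t z ε : ℝ} (hs : s ≠ 0) (ht : t ≠ 0) (hε : ε ^ 2 = 1)
    (hz : 0 < ε * z) :
    ε * √(t ^ 2 + s ^ 2 - 2 * s * t * ((t ^ 2 + s ^ 2 - z ^ 2) / (2 * s * t))) = z := by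
  rw [mul_div_cancel₀ _ (by simp [hs, ht] : 2 * s * t ≠ 0),
    show t ^ 2 + s ^ 2 - (t ^ 2 + s ^ 2 - z ^ 2) = (ε * z) ^ 2 by rw [mul_pow, hε]; ring,
    Real.sqrt_sq hz.le, ← mul_assoc, ← sq, hε, one_mul]

/-- The contribution to the translation of the half line of sign `ε`, as a function of `u`. -/
noncomputable def signedFactor (κ s t ε u : ℝ) : ℝ :=
  (1 + (t - s) / (ε * √(t ^ 2 + s ^ 2 - 2 * s * t * u))) * Phi κ u

lemma signedFactor_norm_le {κ s t ε u : ℝ} (hε : ε ^ 2 = 1) (hu : u ∈ Set.Ioo (-1 : ℝ) 1) :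
    ‖signedFactor κ s t ε u‖ ≤ 4 * |bk κ| * (1 - u ^ 2) ^ (κ - 1) := by
  have hpos : 0 ≤ t ^ 2 + s ^ 2 - 2 * s * t * u := by
    obtain ⟨h1, h2⟩ := hu
    nlinarith [mul_nonneg (sub_nonneg.2 h2.le) (sq_nonneg (t + s)),
      mul_nonneg (show 0 ≤ 1 + u by linarith) (sq_nonneg (t - s))]
  have h1 : 0 ≤ (1 - u ^ 2) ^ (κ - 1) :=
    Real.rpow_nonneg (by nlinarith [hu.1, hu.2]) _
  have h := abs_one_add_div_mul_one_add_le hu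
    (z := ε * √(t ^ 2 + s ^ 2 - 2 * s * t * u)) (s := s) (t := t)
    (by rw [mul_pow, hε, Real.sq_sqrt hpos, one_mul])
  have e : signedFactor κ s t ε u =
      (1 + (t - s) / (ε * √(t ^ 2 + s ^ 2 - 2 * s * t * u))) * (1 + u) * bk κ *
        (1 - u ^ 2) ^ (κ - 1) := by
    unfold signedFactor Phi
    ring
  rw [e, Real.norm_eq_abs, abs_mul, abs_mul, abs_of_nonneg h1]
  gcongr

lemma measurable_signedFactor (κ s t ε : ℝ) : Measurable (signedFactor κ s t ε) := by
  unfold signedFactor Phi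
  fun_prop

lemma integrableOn_comp_mul_signedFactor {κ : ℝ} (hκ : 0 < κ) (s t : ℝ) {ε : ℝ}
    (hε : ε ^ 2 = 1) {f : ℝ → ℂ} (hfm : Measurable f) {C : ℝ} (hC : ∀ x, ‖f x‖ ≤ C) :
    IntegrableOn (fun u => f (ε * √(t ^ 2 + s ^ 2 - 2 * s * t * u)) *
      (signedFactor κ s t ε u : ℂ)) (Set.Ioo (-1) 1) := by
  have hm := measurable_signedFactor κ s t ε
  refine Integrable.mono' (((integrableOn_one_sub_sq_rpow hκ).const_mul (4 * |bk κ|)).const_mul C)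
    (by fun_prop) ?_
  filter_upwards [ae_restrict_mem measurableSet_Ioo] with u hu
  rw [norm_mul, Complex.norm_real]
  exact mul_le_mul (hC _) (signedFactor_norm_le hε hu) (norm_nonneg _)
    ((norm_nonneg _).trans (hC 0))

lemma translationKernel_eq_of_mem {κ s t z ε : ℝ} (hs : s ≠ 0) (ht : t ≠ 0) (hε : ε ^ 2 = 1)
    (hz : z ∈ signedSupport s t ε) :
    translationKernel κ s t z = |-z / (s * t)| *
      signedFactor κ s t ε ((t ^ 2 + s ^ 2 - z ^ 2) / (2 * s * t)) * |t| ^ (2 * κ) := by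
  rw [translationKernel, if_pos hz.1, translationDensity, signedFactor,
    signed_sqrt_eq hs ht hε hz.2]

lemma integral_signedSupport {κ s t ε : ℝ} (hs : s ≠ 0) (ht : t ≠ 0) (hε : ε ^ 2 = 1)
    (f : ℝ → ℂ) :
    ∫ z in signedSupport s t ε, f z * (translationKernel κ s t z : ℂ) =
      (∫ u in Set.Ioo (-1 : ℝ) 1, f (ε * √(t ^ 2 + s ^ 2 - 2 * s * t * u)) *
        (signedFactor κ s t ε u : ℂ)) * ((|t| ^ (2 * κ) : ℝ) : ℂ) := by
  rw [← image_signedSupport hs ht hε, integral_image_eq_integral_abs_deriv_smul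
    (measurableSet_signedSupport s t ε)
    (fun z _ => hasDerivWithinAt_signedSupport s t _ z) (injOn_signedSupport hs ht),
    ← integral_mul_const]
  refine setIntegral_congr_fun (measurableSet_signedSupport s t ε) fun z hz => ?_
  simp only [translationKernel_eq_of_mem hs ht hε hz, signed_sqrt_eq hs ht hε hz.2,
    Complex.real_smul]
  push_cast
  ring

lemma lintegral_signedSupport_le {κ s t ε : ℝ} (hs : s ≠ 0) (ht : t ≠ 0) (hε : ε ^ 2 = 1) :
    ∫⁻ z in signedSupport s t ε, ‖translationKernel κ s t z‖ₑ ≤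
      (∫⁻ u in Set.Ioo (-1 : ℝ) 1, ‖4 * |bk κ| * (1 - u ^ 2) ^ (κ - 1)‖ₑ) *
        ENNReal.ofReal (|t| ^ (2 * κ)) := by
  have h : ∫⁻ z in signedSupport s t ε, ‖translationKernel κ s t z‖ₑ =
      (∫⁻ u in Set.Ioo (-1 : ℝ) 1, ‖signedFactor κ s t ε u‖ₑ) *
        ENNReal.ofReal (|t| ^ (2 * κ)) := by
    rw [← image_signedSupport hs ht hε, lintegral_image_eq_lintegral_abs_deriv_mul
      (measurableSet_signedSupport s t ε)
      (fun z _ => hasDerivWithinAt_signedSupport s t _ z) (injOn_signedSupport hs ht),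
      ← lintegral_mul_const']
    · refine setLIntegral_congr_fun (measurableSet_signedSupport s t ε) fun z hz => ?_
      simp only [translationKernel_eq_of_mem hs ht hε hz, enorm_mul]
      rw [Real.enorm_of_nonneg (abs_nonneg _),
        Real.enorm_of_nonneg (Real.rpow_nonneg (abs_nonneg t) (2 * κ))]
    · exact ENNReal.ofReal_ne_top
  rw [h]
  gcongr ?_ * _
  refine setLIntegral_mono' measurableSet_Ioo fun u hu => ?_
  rw [enorm_le_iff_norm_le]
  exact (signedFactor_norm_le hε hu).trans (le_abs_self _)

lemma translationSupport_ae_eq (s t : ℝ) :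
    translationSupport s t =ᵐ[volume] (signedSupport s t 1 ∪ signedSupport s t (-1) : Set ℝ) := by
  filter_upwards [Measure.ae_ne volume (0 : ℝ)] with z hz
  refine propext ⟨fun h => ?_, fun h => ?_⟩
  · rcases lt_or_gt_of_ne hz with h0 | h0
    · exact Or.inr ⟨h, by simpa using h0⟩
    · exact Or.inl ⟨h, by simpa using h0⟩
  · exact h.elim (·.1) (·.1)

lemma disjoint_signedSupport (s t : ℝ) :
    Disjoint (signedSupport s t 1) (signedSupport s t (-1)) := by
  refine Set.disjoint_left.2 fun z h1 h2 => ?_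
  have a : 0 < 1 * z := h1.2
  have b : 0 < -1 * z := h2.2
  linarith

lemma lintegral_translationKernel_le {κ s t : ℝ} (hs : s ≠ 0) (ht : t ≠ 0) :
    ∫⁻ z, ‖translationKernel κ s t z‖ₑ ≤
      2 * (∫⁻ u in Set.Ioo (-1 : ℝ) 1, ‖4 * |bk κ| * (1 - u ^ 2) ^ (κ - 1)‖ₑ) *
        ENNReal.ofReal (|t| ^ (2 * κ)) := by
  have h0 : ∫⁻ z, ‖translationKernel κ s t z‖ₑ =
      ∫⁻ z in translationSupport s t, ‖translationKernel κ s t z‖ₑ := by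
    refine (setLIntegral_eq_of_support_subset ?_).symm
    intro z hz
    by_contra h
    exact hz (by simp [translationKernel, h])
  rw [h0, setLIntegral_congr (translationSupport_ae_eq s t),
    lintegral_union (measurableSet_signedSupport s t _) (disjoint_signedSupport s t), mul_assoc,
    two_mul]
  exact add_le_add (lintegral_signedSupport_le hs ht (by norm_num))
    (lintegral_signedSupport_le hs ht (by norm_num))

lemma integrable_translationKernel {κ : ℝ} (hκ : 0 < κ) {s t : ℝ} (hs : s ≠ 0) (ht : t ≠ 0) :
    Integrable (translationKernel κ s t) := by
  have hfin : (∫⁻ u in Set.Ioo (-1 : ℝ) 1, ‖4 * |bk κ| * (1 - u ^ 2) ^ (κ - 1)‖ₑ) < ⊤ :=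
    ((integrableOn_one_sub_sq_rpow hκ).const_mul (4 * |bk κ|)).2
  have hKm : Measurable (translationKernel κ s t) :=
    Measurable.of_uncurry_left (f := translationKernel κ s) (measurable_translationKernel κ s)
  refine ⟨hKm.aestronglyMeasurable, ?_⟩
  rw [HasFiniteIntegral]
  refine (lintegral_translationKernel_le hs ht).trans_lt ?_
  generalize (∫⁻ u in Set.Ioo (-1 : ℝ) 1, ‖4 * |bk κ| * (1 - u ^ 2) ^ (κ - 1)‖ₑ) = I at hfin
  finiteness

/-- The generalized translation is the integral operator with kernel `translationKernel`. -/
lemma integral_translationKernel {κ : ℝ} (hκ : 0 < κ) {s t : ℝ} (hs : s ≠ 0) (ht : t ≠ 0)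
    {f : ℝ → ℂ} (hfm : Measurable f) {C : ℝ} (hC : ∀ x, ‖f x‖ ≤ C) :
    ((|t| ^ (2 * κ) : ℝ) : ℂ) * tau κ s f t =
      (1 / 2 : ℂ) * ∫ z, f z * (translationKernel κ s t z : ℂ) := by
  have hK := integrable_translationKernel hκ hs ht
  have hfK : Integrable (fun z => f z * (translationKernel κ s t z : ℂ)) :=
    hK.ofReal.bdd_mul hfm.aestronglyMeasurable (Eventually.of_forall hC)
  have h0 : ∫ z, f z * (translationKernel κ s t z : ℂ) =
      ∫ z in translationSupport s t, f z * (translationKernel κ s t z : ℂ) := by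
    refine (setIntegral_eq_integral_of_forall_compl_eq_zero fun z h => ?_).symm
    simp [translationKernel, h]
  rw [h0, setIntegral_congr_set (translationSupport_ae_eq s t),
    setIntegral_union (disjoint_signedSupport s t) (measurableSet_signedSupport s t _)
      hfK.integrableOn hfK.integrableOn,
    integral_signedSupport hs ht (by norm_num), integral_signedSupport hs ht (by norm_num),
    ← add_mul, ← integral_add (integrableOn_comp_mul_signedFactor hκ s t (by norm_num) hfm hC)
      (integrableOn_comp_mul_signedFactor hκ s t (by norm_num) hfm hC), tau, mul_left_comm]
  congr 1
  rw [mul_comm]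
  congr 1
  refine integral_congr_ae (Eventually.of_forall fun u => ?_)
  simp only [signedFactor, one_mul, neg_mul, div_neg]
  push_cast
  ring

lemma tau_zero (κ : ℝ) (f : ℝ → ℂ) {t : ℝ} (ht : t ≠ 0) :
    tau κ 0 f t = f t * ∫ u in Set.Ioo (-1 : ℝ) 1, ((Phi κ u : ℝ) : ℂ) := by
  have h : (f |t| * ((1 + t / |t| : ℝ) : ℂ) + f (-|t|) * ((1 - t / |t| : ℝ) : ℂ)) = 2 * f t := by
    rcases lt_or_gt_of_ne ht with h | h
    · rw [abs_of_neg h, div_neg, div_self ht, neg_neg]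
      norm_num
      ring
    · rw [abs_of_pos h, div_self ht]
      norm_num
      ring
  have e : t ^ 2 + (0 : ℝ) ^ 2 = t ^ 2 := by ring
  simp only [tau, mul_zero, zero_mul, sub_zero, e, Real.sqrt_sq_eq_abs, h]
  rw [integral_const_mul]
  ring

lemma integral_mu (κ : ℝ) (F : ℝ → ℂ) :
    ∫ t, F t ∂(mu κ) = ∫ t, ((|t| ^ (2 * κ) : ℝ) : ℂ) * F t := by
  rw [mu, integral_withDensity_eq_integral_toReal_smul (by fun_prop)
    (Eventually.of_forall fun _ => ENNReal.ofReal_lt_top)]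
  refine integral_congr_ae (Eventually.of_forall fun t => ?_)
  simp only [Complex.real_smul]
  rw [ENNReal.toReal_ofReal (by positivity)]

/-- The integrability that allows the order of integration to be changed in the adjoint relation. -/
lemma integrable_mul_translationKernel_mul {κ : ℝ} (hκ : 0 < κ) {s : ℝ} (hs : s ≠ 0)
    {f g : ℝ → ℂ} (hfm : Measurable f) (hgm : Measurable g) {C : ℝ} (hC : ∀ x, ‖f x‖ ≤ C)
    (hg : Integrable g (mu κ)) :
    Integrable (fun p : ℝ × ℝ => f p.2 * (translationKernel κ s p.1 p.2 : ℂ) * g p.1)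
      (volume.prod volume) := by
  have hKm := measurable_translationKernel κ s
  have hfin : (∫⁻ u in Set.Ioo (-1 : ℝ) 1, ‖4 * |bk κ| * (1 - u ^ 2) ^ (κ - 1)‖ₑ) < ⊤ :=
    ((integrableOn_one_sub_sq_rpow hκ).const_mul (4 * |bk κ|)).2
  have hm : Measurable
      (fun p : ℝ × ℝ => f p.2 * (translationKernel κ s p.1 p.2 : ℂ) * g p.1) :=
    ((hfm.comp measurable_snd).mul (Complex.measurable_ofReal.comp hKm)).mul
      (hgm.comp measurable_fst)
  have hg2 : ∫⁻ t, ENNReal.ofReal (|t| ^ (2 * κ)) * ‖g t‖ₑ < ⊤ := by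
    have h := hg.2
    rw [HasFiniteIntegral, mu, lintegral_withDensity_eq_lintegral_mul _ (by fun_prop)
      (by fun_prop)] at h
    exact h
  refine ⟨hm.aestronglyMeasurable, ?_⟩
  rw [HasFiniteIntegral, lintegral_prod _ hm.enorm.aemeasurable]
  generalize hI : (∫⁻ u in Set.Ioo (-1 : ℝ) 1, ‖4 * |bk κ| * (1 - u ^ 2) ^ (κ - 1)‖ₑ) = I
    at hfin
  calc _ ≤ ∫⁻ t, ENNReal.ofReal C * (2 * I) * (ENNReal.ofReal (|t| ^ (2 * κ)) * ‖g t‖ₑ) := by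
        refine lintegral_mono_ae ?_
        filter_upwards [Measure.ae_ne volume (0 : ℝ)] with t ht
        calc _ ≤ ∫⁻ z, ENNReal.ofReal C * ‖translationKernel κ s t z‖ₑ * ‖g t‖ₑ := by
              refine lintegral_mono fun z => ?_
              simp only [enorm_mul]
              have h1 : ‖f z‖ₑ ≤ ENNReal.ofReal C := by
                rw [← ofReal_norm]
                exact ENNReal.ofReal_le_ofReal (hC z)
              have h2 : ‖(translationKernel κ s t z : ℂ)‖ₑ = ‖translationKernel κ s t z‖ₑ := by
                rw [← ofReal_norm, ← ofReal_norm, Complex.norm_real]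
              rw [h2]
              gcongr
          _ = ENNReal.ofReal C * (∫⁻ z, ‖translationKernel κ s t z‖ₑ) * ‖g t‖ₑ := by
              rw [lintegral_mul_const' _ _ (by simp), lintegral_const_mul' _ _ (by simp)]
          _ ≤ ENNReal.ofReal C * (2 * I * ENNReal.ofReal (|t| ^ (2 * κ))) * ‖g t‖ₑ := by
              rw [← hI]
              gcongr
              exact lintegral_translationKernel_le hs ht
          _ = _ := by ring
    _ < ⊤ := by
        rw [lintegral_const_mul' _ _ (by finiteness)]
        exact ENNReal.mul_lt_top (by finiteness) hg2

/-- the adjoint relation `∫ (τ_s f) g dμ_κ = ∫ f (τ_{-s} g) dμ_κ`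
for bounded measurable `f, g ∈ L¹(μ_κ)`. -/
theorem translation_adjoint (κ : ℝ) (hκ : 0 < κ) (s : ℝ) (f g : ℝ → ℂ)
    (hfm : Measurable f) (hgm : Measurable g)
    (hfb : ∃ C : ℝ, ∀ x, ‖f x‖ ≤ C) (hgb : ∃ C : ℝ, ∀ x, ‖g x‖ ≤ C)
    (hf1 : Integrable f (mu κ)) (hg1 : Integrable g (mu κ)) :
    ∫ t, tau κ s f t * g t ∂(mu κ) = ∫ t, f t * tau κ (-s) g t ∂(mu κ) := by
  obtain ⟨C, hC⟩ := hfb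
  obtain ⟨C', hC'⟩ := hgb
  rw [integral_mu, integral_mu]
  rcases eq_or_ne s 0 with rfl | hs
  · refine integral_congr_ae ?_
    filter_upwards [Measure.ae_ne volume (0 : ℝ)] with t ht
    rw [neg_zero, tau_zero κ f ht, tau_zero κ g ht]
    ring
  calc _ = ∫ t, (1 / 2 : ℂ) * ∫ z, f z * (translationKernel κ s t z : ℂ) * g t := by
        refine integral_congr_ae ?_
        filter_upwards [Measure.ae_ne volume (0 : ℝ)] with t ht
        rw [← mul_assoc, integral_translationKernel hκ hs ht hfm hC, integral_mul_const, mul_assoc]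
    _ = ∫ z, (1 / 2 : ℂ) * ∫ t, f z * (translationKernel κ s t z : ℂ) * g t := by
        rw [integral_const_mul, integral_const_mul, integral_integral_swap]
        exact integrable_mul_translationKernel_mul hκ hs hfm hgm hC hg1
    _ = _ := by
        refine integral_congr_ae ?_
        filter_upwards [Measure.ae_ne volume (0 : ℝ)] with z hz
        rw [mul_left_comm, integral_translationKernel hκ (neg_ne_zero.2 hs) hz hgm hC',
          mul_left_comm (f z), ← integral_const_mul (f z)]
        congr 1
        refine integral_congr_ae ?_
        filter_upwards [Measure.ae_ne volume (0 : ℝ)] with t ht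
        rw [translationKernel_symm hs ht hz]
        ring
end
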